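/- arXiv:2604.00072 — 5 statements merged into one kernel-verified Lean document; each statement's English description precedes it below -/
import Mathlib

section
/- Let P⁺ and P⁻ be probability measures on a measurable space with P⁺ absolutely continuous with respect to P⁻, let p > 1, c > 0, and suppose there exists α₀ > p/(p−1) such that ∫ (dP⁺/dP⁻)^{α₀} dP⁻ < ∞. Then for any sequence of measurable acceptance sets (A_n)_{n≥1} with P⁻(A_n) ≤ c·n^{−p} for all n, the series ∑_{n=1}^∞ P⁺(A_n) converges. In particular, bounded risk ∑ δ_n < ∞ under a power-law schedule forces bounded utility ∑ TPR_n < ∞, so the dual conditions for safe self-improvement cannot hold simultaneously. -/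
open MeasureTheory ENNReal

/-- Power-law risk schedules force bounded utility: if P⁺ ≪ P⁻, the Rényi moment
∫ (dP⁺/dP⁻)^{α₀} dP⁻ is finite for some α₀ > p/(p−1), and P⁻(A n) ≤ c·n^{−p},
then ∑ P⁺(A n) converges. (Indices n ≥ 1 are represented as n+1, n : ℕ.) -/
theorem stmt_1 {Ω : Type*} [MeasurableSpace Ω]
    (Pp Pm : Measure Ω) [IsProbabilityMeasure Pp] [IsProbabilityMeasure Pm]
    (hac : Pp ≪ Pm) (p c : ℝ) (hp : 1 < p) (hc : 0 < c)
    (α₀ : ℝ) (hα₀ : p / (p - 1) < α₀)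
    (hfin : (∫⁻ x, (Pp.rnDeriv Pm x) ^ α₀ ∂Pm) < ⊤)
    (A : ℕ → Set Ω) (hAmeas : ∀ n, MeasurableSet (A n))
    (hbound : ∀ n : ℕ, Pm (A n) ≤ ENNReal.ofReal (c * ((n : ℝ) + 1) ^ (-p))) :
    (∑' n : ℕ, Pp (A n)) < ⊤ := by
  have hp1 : 0 < p - 1 := by linarith
  have hα1 : 1 < α₀ := lt_trans (by rw [lt_div_iff₀ hp1]; linarith) hα₀
  have hq := Real.HolderConjugate.conjExponent hα1
  set q := Real.conjExponent α₀ with hqdef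
  have hqinv : 1 / q = 1 - 1 / α₀ := by
    have h := hq.inv_add_inv_eq_one
    simp only [one_div]
    linarith
  have hq0 : 0 ≤ 1 / q := by
    have := hq.symm.pos
    positivity
  have hexp : 1 < p * (1 / q) := by
    rw [hqinv]
    have h0 : 0 < α₀ := by linarith
    rw [div_lt_iff₀ hp1] at hα₀
    have : p * (1 - 1 / α₀) - 1 = (α₀ * (p - 1) - p) / α₀ := by
      field_simp
      ring
    have h2 : 0 < (α₀ * (p - 1) - p) / α₀ := div_pos (by linarith) h0
    linarith
  set K := (∫⁻ x, (Pp.rnDeriv Pm x) ^ α₀ ∂Pm) ^ (1 / α₀) with hK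
  have hKtop : K ≠ ⊤ := ENNReal.rpow_ne_top_of_nonneg (by positivity) hfin.ne
  have key : ∀ n : ℕ, Pp (A n) ≤
      K * ENNReal.ofReal (c ^ (1 / q) * ((n : ℝ) + 1) ^ (-(p * (1 / q)))) := by
    intro n
    have h1 : Pp (A n) = ∫⁻ x in A n, Pp.rnDeriv Pm x ∂Pm :=
      (Measure.setLIntegral_rnDeriv hac (A n)).symm
    have h2 := ENNReal.lintegral_mul_le_Lp_mul_Lq (Pm.restrict (A n)) hq
      (f := Pp.rnDeriv Pm) (g := fun _ => 1)
      (Measure.measurable_rnDeriv Pp Pm).aemeasurable aemeasurable_const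
    simp only [Pi.mul_apply, mul_one, ENNReal.one_rpow, lintegral_const, one_mul,
      Measure.restrict_apply_univ] at h2
    rw [h1]
    refine h2.trans (mul_le_mul' ?_ ?_)
    · exact ENNReal.rpow_le_rpow (setLIntegral_le_lintegral _ _) (by positivity)
    · refine (ENNReal.rpow_le_rpow (hbound n) hq0).trans_eq ?_
      have hn : (0 : ℝ) < (n : ℝ) + 1 := by positivity
      rw [ENNReal.ofReal_rpow_of_nonneg (by positivity) hq0,
        Real.mul_rpow hc.le (by positivity), ← Real.rpow_mul hn.le, neg_mul]
  have hsum : Summable (fun n : ℕ => c ^ (1 / q) * ((n : ℝ) + 1) ^ (-(p * (1 / q)))) := by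
    have h := (summable_nat_add_iff 1).2 (Real.summable_nat_rpow.2 (neg_lt_neg hexp))
    refine Summable.mul_left _ ?_
    simpa using h
  refine (ENNReal.tsum_le_tsum key).trans_lt ?_
  rw [ENNReal.tsum_mul_left]
  exact ENNReal.mul_lt_top hKtop.lt_top hsum.tsum_ofReal_lt_top
end

section
/- Let E be a normed real vector space, X a metric space, S ⊆ X, and f : E → X an L-Lipschitz map with L > 0. Let P⁻ be a probability measure on E concentrated on the unsafe parameters {θ : f(θ) ∉ S} (i.e., P⁻ assigns measure zero to {θ : f(θ) ∈ S}), and let P⁺ be a probability measure on E. Suppose θ₀ ∈ E has f(θ₀) ∈ S with infimum distance from f(θ₀) to Sᶜ at least m > 0, and that q := P⁺(B(θ₀, m/L)) > 0 where B(θ₀, m/L) is the open ball of radius m/L. Then the constant gate with acceptance set A_n = B(θ₀, m/L) for all n satisfies δ_n = P⁻(A_n) = 0 for every n and ∑_{n=1}^∞ P⁺(A_n) = ∑ q = ∞; hence a verification-based gate satisfies the dual conditions for safe self-improvement. -/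
open MeasureTheory Metric

/-- Verification escape: the constant gate A_n = B(θ₀, m/L) has false-accept
rate P⁻(A_n) = 0 at every step and total utility ∑ P⁺(A_n) = ∞, i.e. it
satisfies the dual conditions for safe self-improvement. -/
theorem stmt_3 {E : Type*} [NormedAddCommGroup E] [NormedSpace ℝ E]
    [MeasurableSpace E]
    {X : Type*} [MetricSpace X] (S : Set X) (f : E → X)
    (L : NNReal) (hL : 0 < L) (hf : LipschitzWith L f)
    (Pm Pp : Measure E) [IsProbabilityMeasure Pm] [IsProbabilityMeasure Pp]
    (hconc : Pm {θ : E | f θ ∈ S} = 0)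
    (θ₀ : E) (hθ₀ : f θ₀ ∈ S) (m : ℝ) (hm : 0 < m)
    (hmargin : m ≤ Metric.infDist (f θ₀) Sᶜ)
    (hq : 0 < Pp (Metric.ball θ₀ (m / L))) :
    (∀ n : ℕ, Pm (Metric.ball θ₀ (m / L)) = 0) ∧
      (∑' n : ℕ, Pp (Metric.ball θ₀ (m / L))) = ⊤ := by
  refine ⟨fun _ => measure_mono_null ?_ hconc, ENNReal.tsum_const_eq_top_of_ne_zero hq.ne'⟩
  intro θ hθ
  by_contra h
  have hLr : (0 : ℝ) < L := hL
  have h1 : Metric.infDist (f θ₀) Sᶜ ≤ dist (f θ₀) (f θ) := Metric.infDist_le_dist_of_mem h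
  have h2 := hf.dist_le_mul θ₀ θ
  have h3 : dist θ₀ θ < m / L := Metric.mem_ball'.1 hθ
  rw [lt_div_iff₀ hLr] at h3
  linarith
end

section
/- Let μ ≥ 0 and let P⁻ be the Gaussian measure N(0,1) and P⁺ the Gaussian measure N(μ,1) on ℝ. Let Φ denote the standard normal cumulative distribution function and Φ⁻¹ its inverse on (0,1). Then for every δ ∈ (0,1) and every measurable set A ⊆ ℝ with P⁻(A) ≤ δ, one has P⁺(A) ≤ Φ(Φ⁻¹(δ) + μ). That is, the Neyman–Pearson-optimal true positive rate at false positive rate δ for the Gaussian mean-shift testing problem is TPR_NP(δ) = Φ(Φ⁻¹(δ) + Δ_s) with Δ_s = μ. -/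
open MeasureTheory ProbabilityTheory Set

/-- The standard normal CDF Φ(x) = ∫_{−∞}^{x} (2π)^{−1/2} e^{−t²/2} dt. -/
noncomputable def stdNormalCDF (x : ℝ) : ℝ :=
  ∫ t in Set.Iic x, (Real.sqrt (2 * Real.pi))⁻¹ * Real.exp (-(t ^ 2) / 2)

/-- The inverse Φ⁻¹ of the standard normal CDF (meaningful on (0,1)). -/
noncomputable def stdNormalCDFInv : ℝ → ℝ :=
  Function.invFun stdNormalCDF

lemma ofReal_stdNormalCDF (x : ℝ) :
    ENNReal.ofReal (stdNormalCDF x) = gaussianReal 0 1 (Iic x) := by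
  rw [gaussianReal_apply_eq_integral 0 one_ne_zero]
  congr 1
  unfold stdNormalCDF
  congr 1
  ext t
  simp [gaussianPDFReal]

lemma stdNormalCDF_eq_cdf : stdNormalCDF = fun x => cdf (gaussianReal 0 1) x := by
  ext x
  have h0 : 0 ≤ stdNormalCDF x := by
    unfold stdNormalCDF
    exact integral_nonneg (fun t => by positivity)
  rw [cdf_eq_real, measureReal_def, ← ofReal_stdNormalCDF, ENNReal.toReal_ofReal h0]

lemma continuous_stdNormalCDF : Continuous stdNormalCDF := by
  rw [stdNormalCDF_eq_cdf, continuous_iff_continuousAt]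
  intro x
  have hm := monotone_cdf (gaussianReal 0 1)
  rw [hm.continuousAt_iff_leftLim_eq_rightLim, StieltjesFunction.rightLim_eq]
  have h := (cdf (gaussianReal 0 1)).measure_singleton x
  rw [measure_cdf] at h
  have := nullSingletonClass_gaussianReal (μ := 0) (v := 1) one_ne_zero
  rw [measure_singleton, eq_comm, ENNReal.ofReal_eq_zero] at h
  exact le_antisymm (hm.leftLim_le le_rfl) (by linarith)

lemma stdNormalCDF_inv (δ : ℝ) (hδ : δ ∈ Set.Ioo (0 : ℝ) 1) :
    stdNormalCDF (stdNormalCDFInv δ) = δ := by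
  apply Function.invFun_eq
  have : δ ∈ range stdNormalCDF := by
    apply mem_range_of_exists_le_of_exists_ge continuous_stdNormalCDF
    · rw [stdNormalCDF_eq_cdf]
      exact ((tendsto_cdf_atBot (gaussianReal 0 1)).eventually_le_const hδ.1).exists
    · rw [stdNormalCDF_eq_cdf]
      exact ((tendsto_cdf_atTop (gaussianReal 0 1)).eventually_const_le hδ.2).exists
  exact this

lemma gaussianReal_Ici (μ c : ℝ) :
    gaussianReal μ 1 (Ici (-c)) = gaussianReal 0 1 (Iic (c + μ)) := by
  have h := gaussianReal_map_const_sub (μ := 0) (v := 1) μ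
  rw [sub_zero] at h
  rw [← h, Measure.map_apply (by fun_prop) measurableSet_Ici]
  congr 1
  ext x
  simp only [mem_preimage, mem_Ici, mem_Iic]
  constructor <;> intro h <;> linarith

lemma gaussianPDF_shift (μ x : ℝ) :
    gaussianPDFReal μ 1 x = Real.exp (μ * x - μ ^ 2 / 2) * gaussianPDFReal 0 1 x := by
  simp only [gaussianPDFReal]
  rw [mul_left_comm, ← Real.exp_add]
  congr 2
  push_cast
  ring

lemma gauss_le (μ c : ℝ) (hμ : 0 ≤ μ) (S : Set ℝ) (hS : MeasurableSet S)
    (h : ∀ x ∈ S, x ≤ -c) :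
    gaussianReal μ 1 S ≤
      ENNReal.ofReal (Real.exp (μ * (-c) - μ ^ 2 / 2)) * gaussianReal 0 1 S := by
  rw [gaussianReal_apply _ one_ne_zero, gaussianReal_apply _ one_ne_zero,
    ← lintegral_const_mul _ (measurable_gaussianPDF 0 1)]
  apply setLIntegral_mono' hS
  intro x hx
  rw [gaussianPDF, gaussianPDF, ← ENNReal.ofReal_mul (by positivity), gaussianPDF_shift]
  apply ENNReal.ofReal_le_ofReal
  apply mul_le_mul_of_nonneg_right _ (gaussianPDFReal_nonneg _ _ _)
  have := mul_le_mul_of_nonneg_left (h x hx) hμ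
  exact Real.exp_le_exp.2 (by linarith)

lemma gauss_ge (μ c : ℝ) (hμ : 0 ≤ μ) (S : Set ℝ) (hS : MeasurableSet S)
    (h : ∀ x ∈ S, -c ≤ x) :
    ENNReal.ofReal (Real.exp (μ * (-c) - μ ^ 2 / 2)) * gaussianReal 0 1 S ≤
      gaussianReal μ 1 S := by
  rw [gaussianReal_apply _ one_ne_zero, gaussianReal_apply _ one_ne_zero,
    ← lintegral_const_mul _ (measurable_gaussianPDF 0 1)]
  apply setLIntegral_mono' hS
  intro x hx
  rw [gaussianPDF, gaussianPDF, ← ENNReal.ofReal_mul (by positivity), gaussianPDF_shift μ]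
  apply ENNReal.ofReal_le_ofReal
  apply mul_le_mul_of_nonneg_right _ (gaussianPDFReal_nonneg _ _ _)
  have := mul_le_mul_of_nonneg_left (h x hx) hμ
  exact Real.exp_le_exp.2 (by linarith)

/-- Neyman–Pearson bound for the Gaussian mean shift: for any measurable A with
N(0,1)(A) ≤ δ, one has N(μ,1)(A) ≤ Φ(Φ⁻¹(δ) + μ). -/
theorem stmt_7 (μ : ℝ) (hμ : 0 ≤ μ) (δ : ℝ) (hδ : δ ∈ Set.Ioo (0 : ℝ) 1)
    (A : Set ℝ) (hA : MeasurableSet A)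
    (hFA : gaussianReal 0 1 A ≤ ENNReal.ofReal δ) :
    gaussianReal μ 1 A ≤ ENNReal.ofReal (stdNormalCDF (stdNormalCDFInv δ + μ)) := by
  set c := stdNormalCDFInv δ with hc
  have hcδ : stdNormalCDF c = δ := stdNormalCDF_inv δ hδ
  rw [ofReal_stdNormalCDF, ← gaussianReal_Ici]
  rw [← hcδ, ofReal_stdNormalCDF] at hFA
  have h0 := gaussianReal_Ici 0 c
  rw [add_zero] at h0
  rw [← h0] at hFA
  have hB : MeasurableSet (Ici (-c)) := measurableSet_Ici
  rw [← measure_inter_add_sdiff A hB, ← measure_inter_add_sdiff (Ici (-c)) hA,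
    inter_comm (Ici (-c)) A] at hFA
  rw [← measure_inter_add_sdiff A hB, ← measure_inter_add_sdiff (Ici (-c)) hA,
    inter_comm (Ici (-c)) A]
  have hd := (ENNReal.add_le_add_iff_left (measure_ne_top _ _)).1 hFA
  refine add_le_add le_rfl ?_
  refine (gauss_le μ c hμ _ (hA.diff hB) ?_).trans
    ((mul_le_mul_right hd _).trans (gauss_ge μ c hμ _ (hB.diff hA) ?_))
  · intro x hx
    exact (not_le.1 hx.2).le
  · intro x hx
    exact hx.1
end

section
/- Let P⁺ and P⁻ be probability measures on a measurable space with P⁺ absolutely continuous with respect to P⁻, let α > 1, β = (α−1)/α, and suppose C_α := (∫ (dP⁺/dP⁻)^α dP⁻)^{1/α} < ∞. Then for every integer N ≥ 1, every B ≥ 0, and all measurable sets A₁, …, A_N with ∑_{n=1}^N P⁻(A_n) ≤ B, one has ∑_{n=1}^N P⁺(A_n) ≤ C_α · N^{1−β} · B^β. In particular, for fixed B the maximum cumulative utility of any classifier sequence over horizon N grows at most like N^{1−β}, strictly sublinearly. -/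
open MeasureTheory ENNReal

/-- Finite-horizon Hölder–Jensen bound: if C_α = (∫ (dP⁺/dP⁻)^α dP⁻)^{1/α} < ∞
and β = (α−1)/α, then for any N measurable acceptance sets with total false
accept budget ∑ P⁻(A_n) ≤ B, the total utility satisfies
∑ P⁺(A_n) ≤ C_α · N^{1−β} · B^β. -/
theorem stmt_12 {Ω : Type*} [MeasurableSpace Ω]
    (Pp Pm : Measure Ω) [IsProbabilityMeasure Pp] [IsProbabilityMeasure Pm]
    (hac : Pp ≪ Pm) (α : ℝ) (hα : 1 < α)
    (hC : (∫⁻ x, (Pp.rnDeriv Pm x) ^ α ∂Pm) ^ (1 / α) < ⊤)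
    (N : ℕ) (hN : 1 ≤ N) (B : ℝ) (hB : 0 ≤ B)
    (A : Fin N → Set Ω) (hAmeas : ∀ n, MeasurableSet (A n))
    (hbudget : (∑ n, Pm (A n)) ≤ ENNReal.ofReal B) :
    (∑ n, Pp (A n)) ≤
      (∫⁻ x, (Pp.rnDeriv Pm x) ^ α ∂Pm) ^ (1 / α) *
        (N : ℝ≥0∞) ^ (1 - (α - 1) / α) * (ENNReal.ofReal B) ^ ((α - 1) / α) := by
  have hpq : α.HolderConjugate (α / (α - 1)) := Real.HolderConjugate.conjExponent hα
  have hα0 : (0 : ℝ) < α := by linarith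
  have hα1 : (0 : ℝ) < α - 1 := by linarith
  set q : ℝ := α / (α - 1) with hq
  have hq0 : 0 < q := by positivity
  have hβ : (α - 1) / α = 1 / q := by rw [hq, one_div_div]
  have hβ' : 1 - (α - 1) / α = 1 / α := by field_simp; ring
  rw [hβ', hβ]
  set C := (∫⁻ x, (Pp.rnDeriv Pm x) ^ α ∂Pm) ^ (1 / α) with hCdef
  have h1 : ∀ n, Pp (A n) ≤ C * Pm (A n) ^ (1 / q) := by
    intro n
    have h := ENNReal.lintegral_mul_le_Lp_mul_Lq (Pm.restrict (A n)) hpq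
      (f := Pp.rnDeriv Pm) (g := fun _ => 1)
      (Measure.measurable_rnDeriv Pp Pm).aemeasurable aemeasurable_const
    simp only [Pi.mul_apply, mul_one, ENNReal.one_rpow, lintegral_const, one_mul,
      Measure.restrict_apply MeasurableSet.univ, Set.univ_inter] at h
    rw [Measure.setLIntegral_rnDeriv hac] at h
    refine h.trans ?_
    gcongr
    refine ENNReal.rpow_le_rpow ?_ (by positivity)
    exact setLIntegral_le_lintegral _ _
  have h2 := ENNReal.inner_le_Lp_mul_Lq Finset.univ (fun _ : Fin N => (1 : ℝ≥0∞))
    (fun n => Pm (A n) ^ (1 / q)) hpq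
  simp only [one_mul, ENNReal.one_rpow, ← ENNReal.rpow_mul, one_div_mul_cancel hq0.ne',
    ENNReal.rpow_one, Finset.sum_const, Finset.card_univ, Fintype.card_fin, nsmul_eq_mul,
    mul_one] at h2
  calc ∑ n, Pp (A n) ≤ ∑ n, C * Pm (A n) ^ (1 / q) := Finset.sum_le_sum fun n _ => h1 n
    _ = C * ∑ n, Pm (A n) ^ (1 / q) := by rw [Finset.mul_sum]
    _ ≤ C * ((N : ℝ≥0∞) ^ (1 / α) * (∑ n, Pm (A n)) ^ (1 / q)) := by gcongr
    _ ≤ C * ((N : ℝ≥0∞) ^ (1 / α) * (ENNReal.ofReal B) ^ (1 / q)) := by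
        gcongr
    _ = _ := by rw [mul_assoc]
end

section
/- Let P⁺ and P⁻ be probability measures on a measurable space with P⁺ absolutely continuous with respect to P⁻, let p > 1, and suppose there exists α > p/(p−1) with (∫ (dP⁺/dP⁻)^α dP⁻)^{1/α} =: C_α < ∞, and set β = (α−1)/α. Then p·β > 1, and for any c > 0 and any sequence of measurable acceptance sets (A_n) with P⁻(A_n) ≤ c·n^{−p}, the cumulative utility satisfies the explicit bound ∑_{n=1}^∞ P⁺(A_n) ≤ C_α · c^β · ∑_{n=1}^∞ n^{−pβ} < ∞, where the series ∑ n^{−pβ} converges since pβ > 1. -/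
open MeasureTheory ENNReal

/-- Quantitative impossibility under a power-law schedule: with
C_α = (∫ (dP⁺/dP⁻)^α dP⁻)^{1/α} < ∞ for some α > p/(p−1) and β = (α−1)/α,
we get p·β > 1 and, for any acceptance sets with P⁻(A_n) ≤ c·n^{−p},
∑ P⁺(A_n) ≤ C_α · c^β · ∑ n^{−pβ} < ∞. (n ≥ 1 is represented as n+1, n : ℕ.) -/
theorem stmt_15 {Ω : Type*} [MeasurableSpace Ω]
    (Pp Pm : Measure Ω) [IsProbabilityMeasure Pp] [IsProbabilityMeasure Pm]
    (hac : Pp ≪ Pm) (p : ℝ) (hp : 1 < p)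
    (α : ℝ) (hα : p / (p - 1) < α)
    (hC : (∫⁻ x, (Pp.rnDeriv Pm x) ^ α ∂Pm) ^ (1 / α) < ⊤)
    (c : ℝ) (hc : 0 < c)
    (A : ℕ → Set Ω) (hAmeas : ∀ n, MeasurableSet (A n))
    (hbound : ∀ n : ℕ, Pm (A n) ≤ ENNReal.ofReal (c * ((n : ℝ) + 1) ^ (-p))) :
    1 < p * ((α - 1) / α) ∧
    (∑' n : ℕ, Pp (A n)) ≤
      (∫⁻ x, (Pp.rnDeriv Pm x) ^ α ∂Pm) ^ (1 / α) *
        (ENNReal.ofReal c) ^ ((α - 1) / α) *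
        (∑' n : ℕ, ENNReal.ofReal (((n : ℝ) + 1) ^ (-(p * ((α - 1) / α))))) ∧
    (∑' n : ℕ, ENNReal.ofReal (((n : ℝ) + 1) ^ (-(p * ((α - 1) / α))))) < ⊤ := by
  have hp1 : 0 < p - 1 := by linarith
  have hα1 : 1 < α := by
    refine lt_trans ?_ hα
    rw [lt_div_iff₀ hp1]; linarith
  have hα0 : 0 < α := by linarith
  have hβ0 : 0 ≤ (α - 1) / α := div_nonneg (by linarith) hα0.le
  have hpb : 1 < p * ((α - 1) / α) := by
    rw [← mul_div_assoc, lt_div_iff₀ hα0]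
    rw [div_lt_iff₀ hp1] at hα
    nlinarith
  refine ⟨hpb, ?_, ?_⟩
  · rw [← ENNReal.tsum_mul_left]
    refine ENNReal.tsum_le_tsum fun n => ?_
    have hn : (0 : ℝ) < (n : ℝ) + 1 := by positivity
    have h1 : Pp (A n) = ∫⁻ x in A n, Pp.rnDeriv Pm x ∂Pm :=
      (Measure.setLIntegral_rnDeriv hac (A n)).symm
    have hq := Real.HolderConjugate.conjExponent hα1
    have h2 := ENNReal.lintegral_mul_le_Lp_mul_Lq (Pm.restrict (A n)) hq
      (f := Pp.rnDeriv Pm) (g := fun _ => 1)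
      (Measure.measurable_rnDeriv Pp Pm).aemeasurable aemeasurable_const
    have he : 1 / Real.conjExponent α = (α - 1) / α := by
      simp [Real.conjExponent]
    rw [he] at h2
    simp only [Pi.mul_apply, mul_one, ENNReal.one_rpow, lintegral_const,
      Measure.restrict_apply_univ, one_mul] at h2
    rw [h1, mul_assoc]
    refine h2.trans ?_
    refine mul_le_mul' (ENNReal.rpow_le_rpow (setLIntegral_le_lintegral _ _) (by positivity)) ?_
    refine (ENNReal.rpow_le_rpow (hbound n) hβ0).trans (le_of_eq ?_)
    rw [ENNReal.ofReal_mul hc.le, ENNReal.mul_rpow_of_nonneg _ _ hβ0,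
      ENNReal.ofReal_rpow_of_pos (Real.rpow_pos_of_pos hn _), ← Real.rpow_mul hn.le, neg_mul]
  · have hs : Summable fun n : ℕ => ((n : ℝ) + 1) ^ (-(p * ((α - 1) / α))) := by
      have h := (summable_nat_add_iff 1).2 (Real.summable_nat_rpow.2 (neg_lt_neg hpb))
      simpa using h
    rw [← ENNReal.ofReal_tsum_of_nonneg (fun n => by positivity) hs]
    exact ENNReal.ofReal_lt_top
end
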